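/- There exists an absolute constant C > 0 such that for every r > 1, α > 0, 1 ≤ p ≤ ∞, every real sequence β̄ = (β_k), and every n ∈ ℕ satisfying n^{1−r} ln(n+1) ≤ α r, one has | Ẽ_n(C^{α,r}_{β̄,1})_{L_p} − e^{−α n^r} (2^{1−1/p}/π^{1+1/p}) ‖cos t‖_p^2 | ≤ C e^{−α n^r}/n. -/

import Mathlib

open MeasureTheory Real Set
open scoped ENNReal

/-- The `L_p` "norm" of a (2π-periodic) function over one period `(0, 2π]`. -/
noncomputable def LpNormPer (p : ℝ≥0∞) (f : ℝ → ℝ) : ℝ :=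
  (eLpNorm f p (volume.restrict (Ioc (0:ℝ) (2*π)))).toReal

/-- `‖cos t‖_p` over one period. -/
noncomputable def cosLp (p : ℝ≥0∞) : ℝ := LpNormPer p Real.cos

/-- `T` is a trigonometric polynomial of order (degree) at most `m`. -/
def IsTrigPolyDeg (m : ℕ) (T : ℝ → ℝ) : Prop :=
  ∃ a b : ℕ → ℝ, ∀ x : ℝ, T x = a 0 / 2 +
    ∑ k ∈ Finset.Icc 1 m, (a k * Real.cos (k * x) + b k * Real.sin (k * x))

/-- Admissible `φ`: 2π-periodic, integrable on a period, `φ ⊥ 1`, `‖φ‖₁ ≤ 1`. -/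
def AdmPhi (φ : ℝ → ℝ) : Prop :=
  (∀ t : ℝ, φ (t + 2*π) = φ t) ∧ IntegrableOn φ (Ioc (0:ℝ) (2*π)) volume ∧
  (∫ t in (0:ℝ)..(2*π), φ t) = 0 ∧ (∫ t in (0:ℝ)..(2*π), |φ t|) ≤ 1

/-- The generating kernel `Ψ_β̄(t) = Σ_{k≥1} ψ(k) cos(kt − πβ_k/2)`. -/
noncomputable def ker1 (ψ βb : ℕ → ℝ) (t : ℝ) : ℝ :=
  ∑' k : ℕ, ψ (k+1) * Real.cos ((k+1 : ℝ) * t - π * βb (k+1) / 2)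

/-- The class `C^ψ_{β̄,1}` of convolutions `f = a₀/2 + (1/π) Ψ_β̄ * φ`. -/
def ClassC (ψ βb : ℕ → ℝ) : Set (ℝ → ℝ) :=
  { f | ∃ a₀ : ℝ, ∃ φ : ℝ → ℝ, AdmPhi φ ∧
      ∀ x : ℝ, f x = a₀ / 2 + (1/π) * ∫ t in (0:ℝ)..(2*π), ker1 ψ βb (x - t) * φ t }

/-- `T` is the interpolation trigonometric polynomial `S̃_{n-1}(f)` of `f` at the
equidistant nodes `x_k^{(n-1)} = 2kπ/(2n-1)`. -/
def InterpolatesAt (n : ℕ) (T f : ℝ → ℝ) : Prop :=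
  IsTrigPolyDeg (n - 1) T ∧
  ∀ k : ℤ, T (2 * (k:ℝ) * π / (2 * (n:ℝ) - 1)) = f (2 * (k:ℝ) * π / (2 * (n:ℝ) - 1))

/-- `Ẽ_n(F)_{L_p} = sup_{f ∈ F} ‖f − S̃_{n-1}(f;·)‖_p`. -/
noncomputable def interpErr (p : ℝ≥0∞) (n : ℕ) (F : Set (ℝ → ℝ)) : ℝ :=
  sSup { e : ℝ | ∃ f ∈ F, ∃ T : ℝ → ℝ, InterpolatesAt n T f ∧
    e = LpNormPer p (fun x => f x - T x) }

theorem lp_memLp {f : ℝ → ℝ} (hf : Continuous f) (p : ℝ≥0∞) :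
    MemLp f p (volume.restrict (Ioc (0:ℝ) (2*π))) := by
  obtain ⟨C, hC⟩ := (isCompact_Icc (a := (0:ℝ)) (b := 2*π)).exists_bound_of_continuousOn
    hf.continuousOn
  refine MemLp.of_bound hf.aestronglyMeasurable C ?_
  refine (ae_restrict_iff' measurableSet_Ioc).2 (Filter.Eventually.of_forall fun x hx => ?_)
  exact hC x ⟨hx.1.le, hx.2⟩

theorem lp_add_le {f g : ℝ → ℝ} (hf : Continuous f) (hg : Continuous g) {p : ℝ≥0∞} (hp : 1 ≤ p) :
    LpNormPer p (fun x => f x + g x) ≤ LpNormPer p f + LpNormPer p g := by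
  unfold LpNormPer
  rw [← ENNReal.toReal_add (lp_memLp hf p).2.ne (lp_memLp hg p).2.ne]
  apply ENNReal.toReal_mono (ENNReal.add_ne_top.2 ⟨(lp_memLp hf p).2.ne, (lp_memLp hg p).2.ne⟩)
  exact eLpNorm_add_le hf.aestronglyMeasurable hg.aestronglyMeasurable hp

theorem lp_const_mul (c : ℝ) (f : ℝ → ℝ) (p : ℝ≥0∞) :
    LpNormPer p (fun x => c * f x) = |c| * LpNormPer p f := by
  unfold LpNormPer
  have := eLpNorm_const_smul c f p (volume.restrict (Ioc (0:ℝ) (2*π)))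
  have h2 : (c • f) = fun x => c * f x := by ext x; simp
  rw [h2] at this
  rw [this, ENNReal.toReal_mul]
  simp

theorem lp_nonneg (f : ℝ → ℝ) (p : ℝ≥0∞) : 0 ≤ LpNormPer p f := ENNReal.toReal_nonneg

theorem lp_bound {f : ℝ → ℝ} {c : ℝ} (hc : 0 ≤ c) (h : ∀ x, |f x| ≤ c) {p : ℝ≥0∞} (hp : 1 ≤ p) :
    LpNormPer p f ≤ c * (2 * π) := by
  have h1 := eLpNorm_le_of_ae_bound (p := p) (μ := volume.restrict (Ioc (0:ℝ) (2*π))) (f := f)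
    (C := c) (Filter.Eventually.of_forall h)
  have hpi : (1:ℝ) ≤ 2 * π := by linarith [Real.pi_gt_three]
  have h2 : (volume.restrict (Ioc (0:ℝ) (2*π))) univ ^ p.toReal⁻¹ ≤ ENNReal.ofReal (2 * π) := by
    rw [Measure.restrict_apply_univ, Real.volume_Ioc, sub_zero]
    have : p.toReal⁻¹ ≤ 1 := by
      by_cases hpt : p = ∞
      · simp [hpt]
      · apply inv_le_one_of_one_le₀
        rw [← ENNReal.toReal_one]
        exact ENNReal.toReal_mono hpt hp
    calc ENNReal.ofReal (2*π) ^ p.toReal⁻¹ ≤ ENNReal.ofReal (2*π) ^ (1:ℝ) := by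
          apply ENNReal.rpow_le_rpow_of_exponent_le _ this
          rw [← ENNReal.ofReal_one]; exact ENNReal.ofReal_le_ofReal hpi
      _ = _ := ENNReal.rpow_one _
  have h3 : eLpNorm f p (volume.restrict (Ioc (0:ℝ) (2*π))) ≤ ENNReal.ofReal (c * (2 * π)) := by
    refine h1.trans ?_
    rw [mul_comm c, ENNReal.ofReal_mul (by linarith)]
    gcongr
  exact ENNReal.toReal_le_of_le_ofReal (by positivity) h3

theorem lp_eq {f : ℝ → ℝ} (hf : Continuous f) {p : ℝ≥0∞} (hp : 1 ≤ p) (hpt : p ≠ ∞) :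
    LpNormPer p f = (∫ x in (0:ℝ)..(2*π), |f x| ^ p.toReal) ^ (p.toReal)⁻¹ := by
  unfold LpNormPer
  have hp0 : p ≠ 0 := by rintro rfl; simp at hp
  have hn : 0 ≤ ∫ x in Ioc (0:ℝ) (2*π), |f x| ^ p.toReal :=
    integral_nonneg fun x => by positivity
  rw [(lp_memLp hf p).eLpNorm_eq_integral_rpow_norm hp0 hpt,
    intervalIntegral.integral_of_le (by positivity)]
  simp only [Real.norm_eq_abs]
  rw [ENNReal.toReal_ofReal (by positivity)]

theorem lp_top_ge {f : ℝ → ℝ} (hf : Continuous f) {x₀ : ℝ} (h0 : 0 < x₀) (h1 : x₀ < 2*π) :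
    |f x₀| ≤ LpNormPer ∞ f := by
  by_contra hlt
  push Not at hlt
  have hU : IsOpen ({x | LpNormPer ∞ f < |f x|} ∩ Ioo 0 (2*π)) :=
    (isOpen_lt continuous_const hf.abs).inter isOpen_Ioo
  have hpos := hU.measure_pos volume ⟨x₀, hlt, h0, h1⟩
  have hae : ∀ᵐ x ∂(volume.restrict (Ioc (0:ℝ) (2*π))), |f x| ≤ LpNormPer ∞ f := by
    have := ae_le_eLpNormEssSup (f := f) (μ := volume.restrict (Ioc (0:ℝ) (2*π)))
    filter_upwards [this] with x hx
    unfold LpNormPer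
    rw [eLpNorm_exponent_top]
    have hfin : eLpNormEssSup f (volume.restrict (Ioc (0:ℝ) (2*π))) ≠ ∞ := by
      rw [← eLpNorm_exponent_top]; exact (lp_memLp hf ∞).2.ne
    have := ENNReal.toReal_mono hfin hx
    simpa using this
  rw [ae_restrict_iff' measurableSet_Ioc, ae_iff] at hae
  have hle : volume ({x | LpNormPer ∞ f < |f x|} ∩ Ioo 0 (2*π)) ≤ 0 := by
    rw [← hae]
    apply measure_mono
    rintro x ⟨hx, hx2⟩
    simp only [mem_ofPred_eq, not_forall]
    exact ⟨⟨hx2.1, hx2.2.le⟩, not_le.2 hx⟩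
  exact absurd hpos (not_lt.2 hle)

theorem cosLp_top : cosLp ∞ = 1 := by
  unfold cosLp
  apply le_antisymm
  · unfold LpNormPer
    apply ENNReal.toReal_le_of_le_ofReal zero_le_one
    have := eLpNorm_le_of_ae_bound (p := ∞) (μ := volume.restrict (Ioc (0:ℝ) (2*π)))
      (f := Real.cos) (C := 1) (Filter.Eventually.of_forall Real.abs_cos_le_one)
    simpa using this
  · have := lp_top_ge Real.continuous_cos (x₀ := π) Real.pi_pos (by linarith [Real.pi_pos])
    simpa using this

/-- The model quantity. -/
noncomputable def FF (p : ℝ≥0∞) (N : ℕ) (δ : ℝ) : ℝ :=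
  LpNormPer p (fun x => Real.sin (N * x / 2) * Real.sin (δ - x / 2))

theorem FF_top_le (N : ℕ) (δ : ℝ) : FF ∞ N δ ≤ 1 := by
  unfold FF LpNormPer
  apply ENNReal.toReal_le_of_le_ofReal zero_le_one
  have := eLpNorm_le_of_ae_bound (p := ∞) (μ := volume.restrict (Ioc (0:ℝ) (2*π)))
      (f := fun x => Real.sin (N * x / 2) * Real.sin (δ - x / 2)) (C := 1)
      (Filter.Eventually.of_forall fun x => by
        rw [Real.norm_eq_abs, abs_mul]
        exact mul_le_one₀ (Real.abs_sin_le_one _) (abs_nonneg _) (Real.abs_sin_le_one _))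
  simpa using this

theorem FF_lip {p : ℝ≥0∞} (hp : 1 ≤ p) (N : ℕ) (δ δ' : ℝ) :
    FF p N δ ≤ FF p N δ' + |δ - δ'| * (2 * π) := by
  unfold FF
  have h1 := lp_add_le (p := p) (f := fun x => Real.sin (N * x / 2) * Real.sin (δ' - x / 2))
    (g := fun x => Real.sin (N * x / 2) * (Real.sin (δ - x / 2) - Real.sin (δ' - x / 2)))
    (by fun_prop) (by fun_prop) hp
  have h2 := lp_bound (p := p) (c := |δ - δ'|)
    (f := fun x => Real.sin (N * x / 2) * (Real.sin (δ - x / 2) - Real.sin (δ' - x / 2)))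
    (abs_nonneg _) (fun x => by
      rw [abs_mul]
      have ha := Real.abs_sin_le_one (N * x / 2)
      have hb : |Real.sin (δ - x / 2) - Real.sin (δ' - x / 2)| ≤ |δ - δ'| := by
        have := Real.abs_sin_sub_sin_le (δ - x/2) (δ' - x/2)
        simpa using this
      calc _ ≤ 1 * |δ - δ'| := mul_le_mul ha hb (abs_nonneg _) zero_le_one
        _ = _ := one_mul _) hp
  have h3 : (fun x => Real.sin (N * x / 2) * Real.sin (δ - x / 2)) = fun x =>
    Real.sin (N * x / 2) * Real.sin (δ' - x / 2) +
      Real.sin (N * x / 2) * (Real.sin (δ - x / 2) - Real.sin (δ' - x / 2)) := by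
    ext x; ring
  rw [h3]
  linarith

theorem lp_top_ge' {f : ℝ → ℝ} (hf : Continuous f) (hper : ∀ x, |f (x + 2*π)| = |f x|) (x₀ : ℝ) :
    |f x₀| ≤ LpNormPer ∞ f := by
  have hP : Function.Periodic (fun x => |f x|) (2*π) := hper
  obtain ⟨y, hy, hxy⟩ := hP.exists_mem_Ico₀ Real.two_pi_pos x₀
  change |f x₀| = |f y| at hxy
  rw [hxy]
  have hcl : IsClosed {x | |f x| ≤ LpNormPer ∞ f} := isClosed_le hf.abs continuous_const
  have hsub : Ioo 0 (2*π) ⊆ {x | |f x| ≤ LpNormPer ∞ f} := fun x hx => lp_top_ge hf hx.1 hx.2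
  have := hcl.closure_subset_iff.2 hsub
  rw [closure_Ioo Real.two_pi_pos.ne] at this
  exact this ⟨hy.1, hy.2.le⟩

theorem abs_sin_half_add (N : ℕ) (x : ℝ) :
    |Real.sin (N * (x + 2*π) / 2)| = |Real.sin (N * x / 2)| := by
  have : (N:ℝ) * (x + 2*π) / 2 = N * x / 2 + N * π := by ring
  rw [this, Real.sin_add_nat_mul_pi, abs_mul]; simp

theorem abs_sin_sub_half_add (δ x : ℝ) :
    |Real.sin (δ - (x + 2*π) / 2)| = |Real.sin (δ - x / 2)| := by
  have : δ - (x + 2*π) / 2 = δ - x / 2 - π := by ring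
  rw [this, Real.sin_sub_pi, abs_neg]

theorem FF_top_ge {N : ℕ} (hN : 1 ≤ N) (δ : ℝ) : 1 - π / N ≤ FF ∞ N δ := by
  have hN0 : (0:ℝ) < N := by exact_mod_cast hN
  have hc : 0 < π / N := by positivity
  obtain ⟨m, hm, -⟩ := existsUnique_add_zsmul_mem_Ico hc (δ - π / (2*N)) (π/2)
  have h := lp_top_ge' (f := fun x => Real.sin (N * x / 2) * Real.sin (δ - x / 2)) (by fun_prop)
    (fun x => by rw [abs_mul, abs_mul, abs_sin_half_add, abs_sin_sub_half_add])
    (π / N - 2 * m * π / N)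
  refine le_trans ?_ h
  rw [abs_mul]
  have e1 : N * (π / N - 2 * m * π / N) / 2 = π / 2 - m * π := by field_simp
  have e2 : δ - (π / N - 2 * m * π / N) / 2 = δ - π / (2*N) + m • (π / N) := by
    rw [zsmul_eq_mul]; field_simp; ring
  rw [e1, e2, Real.sin_sub_int_mul_pi, abs_mul]
  simp only [abs_zpow, abs_neg, abs_one, one_zpow, Real.sin_pi_div_two, one_mul]
  set y := δ - π / (2*N) + m • (π / N)
  have h3 := Real.abs_sin_sub_sin_le y (π/2)
  rw [Real.sin_pi_div_two, abs_of_nonneg (sub_nonneg.2 hm.1)] at h3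
  have h4 := (abs_le.1 h3).1
  have h5 := le_abs_self (Real.sin y)
  have := hm.2
  linarith

theorem integral_scale {g : ℝ → ℝ} (hg : Continuous g) (hper : Function.Periodic g (2*π)) {N : ℕ}
    (hN : 1 ≤ N) : ∫ x in (0:ℝ)..(2*π), g (N * x) = ∫ x in (0:ℝ)..(2*π), g x := by
  have hN0 : (0:ℝ) < N := by exact_mod_cast hN
  rw [intervalIntegral.integral_comp_mul_left g hN0.ne']
  have := hper.intervalIntegral_add_zsmul_eq N 0 (fun a b => hg.intervalIntegrable a b)
  simp only [zero_add, zsmul_eq_mul, Int.cast_natCast] at this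
  rw [mul_zero, this, smul_eq_mul]
  field_simp

theorem integral_shift {g : ℝ → ℝ} (hper : Function.Periodic g (2*π)) (a : ℝ) :
    ∫ x in (0:ℝ)..(2*π), g (x + a) = ∫ x in (0:ℝ)..(2*π), g x := by
  rw [intervalIntegral.integral_comp_add_right g a]
  have := hper.intervalIntegral_add_eq a 0
  rw [zero_add, add_comm (2*π) a, this, zero_add]

/-- The integral `∫ |cos|^q`. -/
noncomputable def cI (q : ℝ) : ℝ := ∫ x in (0:ℝ)..(2*π), |Real.cos x| ^ q

theorem sin_shift_int {q : ℝ} (a : ℝ) :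
    ∫ x in (0:ℝ)..(2*π), |Real.sin (x + a)| ^ q = cI q := by
  have hper : Function.Periodic (fun x => |Real.cos x| ^ q) (2*π) := fun x => by simp
  have := integral_shift hper (a - π/2)
  unfold cI
  rw [← this]
  congr 1; ext x
  rw [← add_sub_assoc, Real.cos_sub_pi_div_two]

theorem sin_half_int {q : ℝ} (hq : 0 ≤ q) {N : ℕ} (hN : 1 ≤ N) :
    ∫ x in (0:ℝ)..(2*π), |Real.sin (N * x / 2)| ^ q = cI q := by
  have hper : Function.Periodic (fun x => |Real.sin x| ^ q) π := fun x => by simp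
  have hc : Continuous (fun x => |Real.sin x| ^ q) :=
    Real.continuous_sin.abs.rpow_const (fun _ => Or.inr hq)
  have h1 := integral_scale (g := fun x => |Real.sin (x/2)| ^ q) 
    (hc.comp (continuous_id.div_const 2)) (fun x => by
      have := abs_sin_half_add 1 x
      simp only [Nat.cast_one, one_mul] at this
      simp only [this]) hN
  rw [h1, intervalIntegral.integral_comp_div (fun x => |Real.sin x| ^ q) two_ne_zero]
  have h2 := hper.intervalIntegral_add_zsmul_eq 2 0 (fun a b => hc.intervalIntegrable a b)
  have h3 := sin_shift_int (q := q) 0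
  simp only [zero_add, zsmul_eq_mul, Int.cast_ofNat, add_zero] at h2 h3
  rw [← h3, h2]
  simp

/-- The `q`-th power of the model quantity. -/
noncomputable def II (q : ℝ) (N : ℕ) (δ : ℝ) : ℝ :=
  ∫ x in (0:ℝ)..(2*π), |Real.sin (N * x / 2) * Real.sin (δ - x / 2)| ^ q

theorem II_nonneg (q : ℝ) (N : ℕ) (δ : ℝ) : 0 ≤ II q N δ :=
  intervalIntegral.integral_nonneg Real.two_pi_pos.le fun x _ => by positivity

theorem FF_eq {p : ℝ≥0∞} (hp : 1 ≤ p) (hpt : p ≠ ∞) (N : ℕ) (δ : ℝ) :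
    FF p N δ = II p.toReal N δ ^ (p.toReal)⁻¹ := lp_eq (by fun_prop) hp hpt

theorem II_periodic (q : ℝ) {N : ℕ} (hN : 1 ≤ N) : Function.Periodic (II q N) (π / N) := by
  intro δ
  have hN0 : (0:ℝ) < N := by exact_mod_cast hN
  unfold II
  have hper : Function.Periodic
      (fun x => |Real.sin (N * x / 2) * Real.sin (δ + π / N - x / 2)| ^ q) (2*π) := fun x => by
    simp only [abs_mul, abs_sin_half_add, abs_sin_sub_half_add]
  rw [← integral_shift hper (2 * π / N)]
  congr 1; ext x
  have e1 : N * (x + 2 * π / N) / 2 = N * x / 2 + π := by field_simp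
  have e2 : δ + π / N - (x + 2 * π / N) / 2 = δ - x / 2 := by ring
  rw [e1, e2, Real.sin_add_pi, neg_mul, abs_neg]

theorem II_avg {q : ℝ} (hq : 0 ≤ q) {N : ℕ} (hN : 1 ≤ N) :
    ∫ δ in (0:ℝ)..(2*π), II q N δ = cI q * cI q := by
  unfold II
  have hc : Continuous (fun z : ℝ × ℝ => |Real.sin (N * z.2 / 2) * Real.sin (z.1 - z.2 / 2)| ^ q) :=
    Continuous.rpow_const (by fun_prop) (fun _ => Or.inr hq)
  rw [intervalIntegral_intervalIntegral_swap]
  · have : ∀ x : ℝ, ∫ δ in (0:ℝ)..(2*π), |Real.sin (N * x / 2) * Real.sin (δ - x / 2)| ^ q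
        = |Real.sin (N * x / 2)| ^ q * cI q := by
      intro x
      rw [← sin_shift_int (-(x/2)), ← intervalIntegral.integral_const_mul]
      congr 1; ext δ
      rw [abs_mul, Real.mul_rpow (abs_nonneg _) (abs_nonneg _), sub_eq_add_neg]
    simp_rw [this]
    rw [intervalIntegral.integral_mul_const, sin_half_int hq hN]
  · have h2 : IsCompact (Icc (0:ℝ) (2*π) ×ˢ Icc (0:ℝ) (2*π)) := isCompact_Icc.prod isCompact_Icc
    have h3 := hc.continuousOn.integrableOn_compact (μ := volume) h2
    refine h3.mono_set ?_
    rw [uIoc_of_le Real.two_pi_pos.le]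
    exact prod_mono Ioc_subset_Icc_self Ioc_subset_Icc_self

theorem II_cont {q : ℝ} (hq : 0 ≤ q) (N : ℕ) : Continuous (II q N) := by
  unfold II
  apply intervalIntegral.continuous_parametric_intervalIntegral_of_continuous'
  exact Continuous.rpow_const (by fun_prop) (fun _ => Or.inr hq)

theorem cI_nonneg (q : ℝ) : 0 ≤ cI q :=
  intervalIntegral.integral_nonneg Real.two_pi_pos.le fun x _ => by positivity

theorem FF_near {p : ℝ≥0∞} (hp : 1 ≤ p) (hpt : p ≠ ∞) {N : ℕ} (hN : 1 ≤ N) (δ δ' : ℝ) :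
    FF p N δ ≤ FF p N δ' + π / N * (2 * π) := by
  have hN0 : (0:ℝ) < N := by exact_mod_cast hN
  have hc : 0 < π / N := by positivity
  have hper : Function.Periodic (FF p N) (π / N) := fun x => by
    rw [FF_eq hp hpt, FF_eq hp hpt, II_periodic _ hN]
  obtain ⟨y, hy, hxy⟩ := hper.exists_mem_Ico hc δ δ'
  rw [hxy]
  refine (FF_lip hp N y δ').trans ?_
  have : |y - δ'| ≤ π / N := by
    rw [abs_of_nonneg (sub_nonneg.2 hy.1)]; linarith [hy.2]
  gcongr

theorem FF_fin {p : ℝ≥0∞} (hp : 1 ≤ p) (hpt : p ≠ ∞) {N : ℕ} (hN : 1 ≤ N) (δ : ℝ) :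
    |FF p N δ - (2*π) ^ (-(1/p.toReal)) * cosLp p ^ 2| ≤ π / N * (2 * π) := by
  have hN0 : (0:ℝ) < N := by exact_mod_cast hN
  set q := p.toReal with hqdef
  have hq1 : 1 ≤ q := by
    rw [hqdef, ← ENNReal.toReal_one]; exact ENNReal.toReal_mono hpt hp
  have hq0 : 0 < q := by linarith
  set e := π / N * (2 * π) with he
  have he0 : 0 ≤ e := by positivity
  have hM : (2*π) ^ (-(1/q)) * cosLp p ^ 2 = ((2*π)⁻¹ * (cI q * cI q)) ^ q⁻¹ := by
    have : cosLp p = cI q ^ q⁻¹ := lp_eq Real.continuous_cos hp hpt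
    rw [this, Real.mul_rpow (by positivity) (mul_nonneg (cI_nonneg q) (cI_nonneg q)),
      Real.mul_rpow (cI_nonneg q) (cI_nonneg q), Real.inv_rpow Real.two_pi_pos.le,
      Real.rpow_neg Real.two_pi_pos.le, one_div, pow_two]
  have hFq : ∀ d, II q N d = FF p N d ^ q := fun d => by
    rw [FF_eq hp hpt, Real.rpow_inv_rpow (II_nonneg _ _ _) hq0.ne']
  have hFn : ∀ d, 0 ≤ FF p N d := fun d => lp_nonneg _ _
  have hcc : 0 ≤ (2*π)⁻¹ * (cI q * cI q) :=
    mul_nonneg (by positivity) (mul_nonneg (cI_nonneg q) (cI_nonneg q))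
  have hint := (II_cont hq0.le N).intervalIntegrable 0 (2*π) (μ := volume)
  rw [hM]
  have up : ((2*π)⁻¹ * (cI q * cI q)) ^ q⁻¹ ≤ FF p N δ + e := by
    rw [Real.rpow_inv_le_iff_of_pos hcc (by linarith [hFn δ]) hq0, ← II_avg hq0.le hN]
    have : ∫ d in (0:ℝ)..(2*π), II q N d ≤ ∫ d in (0:ℝ)..(2*π), (FF p N δ + e) ^ q := by
      apply intervalIntegral.integral_mono_on Real.two_pi_pos.le hint
        intervalIntegrable_const
      intro d _
      rw [hFq]
      exact Real.rpow_le_rpow (hFn d) (FF_near hp hpt hN d δ) hq0.le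
    rw [intervalIntegral.integral_const, smul_eq_mul, sub_zero] at this
    rw [inv_mul_le_iff₀ Real.two_pi_pos]
    exact this
  have lo : FF p N δ - e ≤ ((2*π)⁻¹ * (cI q * cI q)) ^ q⁻¹ := by
    rcases le_or_gt (FF p N δ - e) 0 with h | h
    · exact h.trans (by positivity)
    rw [Real.le_rpow_inv_iff_of_pos h.le hcc hq0, ← II_avg hq0.le hN]
    have : ∫ d in (0:ℝ)..(2*π), (FF p N δ - e) ^ q ≤ ∫ d in (0:ℝ)..(2*π), II q N d := by
      apply intervalIntegral.integral_mono_on Real.two_pi_pos.le 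
        intervalIntegrable_const hint
      intro d _
      rw [hFq]
      exact Real.rpow_le_rpow h.le (by linarith [FF_near hp hpt hN δ d]) hq0.le
    rw [intervalIntegral.integral_const, smul_eq_mul, sub_zero] at this
    rw [le_inv_mul_iff₀ Real.two_pi_pos]
    exact this
  rw [abs_le]; constructor <;> linarith

theorem FF_main {p : ℝ≥0∞} (hp : 1 ≤ p) {N : ℕ} (hN : 1 ≤ N) (δ : ℝ) :
    |FF p N δ - (2*π) ^ (-(1/p.toReal)) * cosLp p ^ 2| ≤ π / N * (2 * π) := by
  by_cases hpt : p = ∞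
  · subst hpt
    have hN0 : (0:ℝ) < N := by exact_mod_cast hN
    have h1 := FF_top_ge hN δ
    have h2 := FF_top_le N δ
    have h3 : π / N * 1 ≤ π / N * (2*π) := by
      gcongr
      linarith [Real.pi_gt_three]
    have h4 : 0 ≤ π / N := by positivity
    simp only [cosLp_top, ENNReal.toReal_top, div_zero, neg_zero, Real.rpow_zero, one_pow, mul_one]
    rw [abs_le]; constructor <;> linarith
  · exact FF_fin hp hpt hN δ

/-- Discrete orthogonality. -/
theorem sum_cos_zero {N : ℕ} (hN : 1 ≤ N) {q : ℤ} (hq : ¬ (N:ℤ) ∣ q) (θ : ℝ) :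
    ∑ j ∈ Finset.range N, Real.cos (q * (2 * j * π / N) + θ) = 0 := by
  have hN0 : (0:ℝ) < N := by exact_mod_cast hN
  have hs : Real.sin (π * q / N) ≠ 0 := by
    intro h
    obtain ⟨m, hm⟩ := Real.sin_eq_zero_iff.1 h
    apply hq
    refine ⟨m, ?_⟩
    have : (q:ℝ) = N * m := by
      field_simp at hm
      linarith
    exact_mod_cast this
  have key : ∀ j : ℕ, 2 * Real.sin (π * q / N) * Real.cos (q * (2 * j * π / N) + θ) =
      Real.sin (q * (2 * (j+1 : ℕ) * π / N) - π * q / N + θ) -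
        Real.sin (q * (2 * j * π / N) - π * q / N + θ) := by
    intro j
    rw [Real.sin_sub_sin]
    congr 2
    · congr 1; push_cast; ring
    · push_cast; ring
  have h2 : 2 * Real.sin (π * q / N) * ∑ j ∈ Finset.range N, Real.cos (q * (2 * j * π / N) + θ)
      = 0 := by
    rw [Finset.mul_sum, Finset.sum_congr rfl (fun j _ => key j),
      Finset.sum_range_sub (fun j : ℕ => Real.sin (q * (2 * j * π / N) - π * q / N + θ))]
    have : (q:ℝ) * (2 * N * π / N) - π * q / N + θ
        = (q * (2 * (0:ℕ) * π / N) - π * q / N + θ) + q * (2 * π) := by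
      field_simp; push_cast; ring
    rw [this, Real.sin_add_int_mul_two_pi, sub_self]
  have h3 : 2 * Real.sin (π * q / N) ≠ 0 := mul_ne_zero two_ne_zero hs
  exact (mul_eq_zero.1 h2).resolve_left h3

/-- Dirichlet kernel. -/
noncomputable def DD (n : ℕ) (u : ℝ) : ℝ := 1 + 2 * ∑ l ∈ Finset.Icc 1 (n-1), Real.cos (l * u)

/-- Interpolation operator. -/
noncomputable def LL (n : ℕ) (f : ℝ → ℝ) (x : ℝ) : ℝ :=
  ((2 * n - 1 : ℕ) : ℝ)⁻¹ * ∑ j ∈ Finset.range (2 * n - 1),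
    f (2 * j * π / (2 * n - 1 : ℕ)) * DD n (x - 2 * j * π / (2 * n - 1 : ℕ))

theorem LL_cos_nat {n m : ℕ} (hn : 1 ≤ n) (hm : m ≤ n - 1) (c x : ℝ) :
    LL n (fun y => Real.cos (m * y - c)) x = Real.cos (m * x - c) := by
  unfold LL
  set N := 2 * n - 1 with hNdef
  have hN : 1 ≤ N := by omega
  have hN0 : (0:ℝ) < N := by exact_mod_cast hN
  rw [inv_mul_eq_iff_eq_mul₀ hN0.ne']
  have hexp : ∀ j : ℕ, Real.cos (m * (2 * j * π / N) - c) * DD n (x - 2 * j * π / N) =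
      Real.cos ((m:ℤ) * (2 * j * π / N) + -c) + ∑ l ∈ Finset.Icc 1 (n-1),
        (Real.cos (((m - l : ℤ) : ℝ) * (2 * j * π / N) + (l * x - c)) +
         Real.cos (((m + l : ℤ) : ℝ) * (2 * j * π / N) + (- (l * x) - c))) := by
    intro j
    unfold DD
    rw [mul_add, mul_one, ← mul_assoc, Finset.mul_sum]
    congr 1
    apply Finset.sum_congr rfl
    intro l _
    rw [mul_comm _ (2:ℝ), Real.two_mul_cos_mul_cos, add_comm]
    congr 2 <;> push_cast <;> ring
  rw [Finset.sum_congr rfl (fun j _ => hexp j), Finset.sum_add_distrib, Finset.sum_comm]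
  simp_rw [Finset.sum_add_distrib]
  have hz2 : ∀ l ∈ Finset.Icc 1 (n-1), ∑ j ∈ Finset.range N,
      Real.cos (((m + l : ℤ) : ℝ) * (2 * j * π / N) + (- (l * x) - c)) = 0 := by
    intro l hl
    rw [Finset.mem_Icc] at hl
    apply sum_cos_zero hN
    intro hd
    have := Int.le_of_dvd (by omega) hd
    omega
  rw [Finset.sum_eq_zero hz2, add_zero]
  have hz1 : ∀ l ∈ Finset.Icc 1 (n-1), l ≠ m → ∑ j ∈ Finset.range N,
      Real.cos (((m - l : ℤ) : ℝ) * (2 * j * π / N) + (l * x - c)) = 0 := by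
    intro l hl hlm
    rw [Finset.mem_Icc] at hl
    apply sum_cos_zero hN
    intro hd
    have := Int.eq_zero_of_abs_lt_dvd hd (by rw [abs_lt]; constructor <;> omega)
    omega
  rcases Nat.eq_zero_or_pos m with h0 | h0
  · subst h0
    rw [Finset.sum_eq_zero (fun l hl => hz1 l hl (by rw [Finset.mem_Icc] at hl; omega))]
    simp
  · rw [Finset.sum_eq_single_of_mem m (by rw [Finset.mem_Icc]; omega) hz1, sum_cos_zero hN]
    · simp
    · intro hd
      have := Int.le_of_dvd (by omega) hd
      omega

theorem LL_cos_int {n : ℕ} {m : ℤ} (hn : 1 ≤ n) (hm : m.natAbs ≤ n - 1) (c x : ℝ) :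
    LL n (fun y => Real.cos (m * y - c)) x = Real.cos (m * x - c) := by
  rcases Int.natAbs_eq m with h | h
  · have := LL_cos_nat hn hm c x
    have hc : (m:ℝ) = (m.natAbs : ℝ) := by
      conv_lhs => rw [h]
      simp
    rw [hc]; exact this
  · have := LL_cos_nat hn hm (-c) x
    have hc : (m:ℝ) = -(m.natAbs : ℝ) := by
      conv_lhs => rw [h]
      simp
    have e : ∀ y, Real.cos (m * y - c) = Real.cos (m.natAbs * y - (-c)) := by
      intro y; rw [hc, ← Real.cos_neg]; congr 1; ring
    simp_rw [e]; exact this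

theorem LL_congr {n : ℕ} {f g : ℝ → ℝ}
    (h : ∀ j : ℕ, f (2 * j * π / (2 * n - 1 : ℕ)) = g (2 * j * π / (2 * n - 1 : ℕ))) (x : ℝ) :
    LL n f x = LL n g x := by
  unfold LL; simp_rw [h]

theorem LL_add {n : ℕ} (f g : ℝ → ℝ) (x : ℝ) :
    LL n (fun y => f y + g y) x = LL n f x + LL n g x := by
  unfold LL
  rw [← mul_add, ← Finset.sum_add_distrib]; simp_rw [add_mul]

theorem LL_mul {n : ℕ} (c : ℝ) (f : ℝ → ℝ) (x : ℝ) :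
    LL n (fun y => c * f y) x = c * LL n f x := by
  unfold LL
  simp_rw [mul_assoc c]
  rw [← Finset.mul_sum]; ring

theorem LL_sum {n : ℕ} {ι : Type} (s : Finset ι) (f : ι → ℝ → ℝ) (x : ℝ) :
    LL n (fun y => ∑ i ∈ s, f i y) x = ∑ i ∈ s, LL n (f i) x := by
  unfold LL
  simp_rw [Finset.sum_mul]
  rw [Finset.sum_comm, Finset.mul_sum]

/-- Aliasing of high frequencies. -/
theorem LL_alias {n : ℕ} (hn : 1 ≤ n) (k m : ℤ) (hm : m.natAbs ≤ n - 1)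
    (hd : ((2 * n - 1 : ℕ) : ℤ) ∣ k - m) (c x : ℝ) :
    LL n (fun y => Real.cos (k * y - c)) x = Real.cos (m * x - c) := by
  rw [← LL_cos_int hn hm c x]
  apply LL_congr
  intro j
  obtain ⟨t, ht⟩ := hd
  have hN0 : ((2 * n - 1 : ℕ) : ℝ) ≠ 0 := by
    have : 2 * n - 1 ≠ 0 := by omega
    exact_mod_cast this
  have hk : (k:ℝ) = m + (2 * n - 1 : ℕ) * t := by
    have : k = m + (2 * n - 1 : ℕ) * t := by omega
    exact_mod_cast this
  have : (k:ℝ) * (2 * j * π / (2 * n - 1 : ℕ)) - c =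
      (m:ℝ) * (2 * j * π / (2 * n - 1 : ℕ)) - c + ((t * j : ℤ) : ℝ) * (2 * π) := by
    rw [hk]; push_cast; field_simp; ring
  rw [this, Real.cos_add_int_mul_two_pi]

theorem LL_trig {n : ℕ} (hn : 1 ≤ n) {T : ℝ → ℝ} (hT : IsTrigPolyDeg (n-1) T) (x : ℝ) :
    LL n T x = T x := by
  obtain ⟨a, b, h⟩ := hT
  have hTe : T = fun y => a 0 / 2 * Real.cos ((0:ℕ) * y - 0) + ∑ k ∈ Finset.Icc 1 (n-1),
      (a k * Real.cos (k * y - 0) + b k * Real.cos (k * y - π / 2)) := by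
    ext y; rw [h]; simp [Real.cos_sub_pi_div_two]
  rw [hTe, LL_add, LL_sum, LL_mul, LL_cos_nat hn (by omega)]
  congr 1
  apply Finset.sum_congr rfl
  intro k hk
  rw [Finset.mem_Icc] at hk
  rw [LL_add, LL_mul, LL_mul, LL_cos_nat hn hk.2, LL_cos_nat hn hk.2]

theorem LL_isTrig (n : ℕ) (f : ℝ → ℝ) : IsTrigPolyDeg (n-1) (LL n f) := by
  set N := 2 * n - 1
  refine ⟨fun k => 2 * ((N:ℝ)⁻¹ * ∑ j ∈ Finset.range N, f (2 * j * π / N) *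
      Real.cos (k * (2 * j * π / N))), fun k => 2 * ((N:ℝ)⁻¹ * ∑ j ∈ Finset.range N,
      f (2 * j * π / N) * Real.sin (k * (2 * j * π / N))), fun x => ?_⟩
  unfold LL DD
  simp_rw [mul_add, mul_one, Finset.sum_add_distrib, mul_add]
  congr 1
  · simp [N]
  · simp only [Finset.mul_sum, Finset.sum_mul]
    rw [Finset.sum_comm, ← Finset.sum_add_distrib]
    apply Finset.sum_congr rfl
    intro l _
    rw [← Finset.sum_add_distrib]
    apply Finset.sum_congr rfl
    intro j _
    rw [mul_sub, Real.cos_sub]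
    ring

theorem LL_cont (n : ℕ) (f : ℝ → ℝ) : Continuous (LL n f) := by
  unfold LL DD; fun_prop

theorem exists_alias {n : ℕ} (hn : 1 ≤ n) (k : ℤ) :
    ∃ m : ℤ, m.natAbs ≤ n - 1 ∧ ((2 * n - 1 : ℕ) : ℤ) ∣ k - m := by
  refine ⟨(k + (n - 1)) % ((2 * n - 1 : ℕ) : ℤ) - (n - 1), ?_, ?_⟩
  · have h1 := Int.emod_nonneg (k + (n - 1)) (b := ((2 * n - 1 : ℕ) : ℤ)) (by omega)
    have h2 := Int.emod_lt_of_pos (k + (n - 1)) (b := ((2 * n - 1 : ℕ) : ℤ)) (by omega)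
    omega
  · have := Int.dvd_self_sub_emod (x := k + (n - 1)) (m := ((2 * n - 1 : ℕ) : ℤ))
    convert this using 1
    ring

/-- Interpolation error of a harmonic. -/
noncomputable def EE (n : ℕ) (k c x : ℝ) : ℝ :=
  Real.cos (k * x - c) - LL n (fun y => Real.cos (k * y - c)) x

theorem EE_le {n : ℕ} (hn : 1 ≤ n) (k : ℕ) (c x : ℝ) : |EE n k c x| ≤ 2 := by
  obtain ⟨m, h1, h2⟩ := exists_alias hn k
  have := LL_alias hn k m h1 h2 c x
  simp only [Int.cast_natCast] at this
  unfold EE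
  rw [this, abs_le]
  constructor <;> linarith [Real.neg_one_le_cos (k * x - c), Real.cos_le_one (k * x - c),
    Real.neg_one_le_cos (m * x - c), Real.cos_le_one (m * x - c)]

theorem EE_low {n : ℕ} (hn : 1 ≤ n) {k : ℕ} (hk : k ≤ n - 1) (c x : ℝ) : EE n k c x = 0 := by
  unfold EE; rw [LL_cos_nat hn hk, sub_self]

theorem EE_n {n : ℕ} (hn : 1 ≤ n) (c x : ℝ) :
    EE n n c x = 2 * (Real.sin ((2 * n - 1 : ℕ) * x / 2) * Real.sin (c - x / 2)) := by
  have := LL_alias hn n (1 - n) (by omega) ⟨1, by omega⟩ c x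
  simp only [Int.cast_natCast] at this
  unfold EE
  rw [this, Real.cos_sub_cos]
  have e1 : ((n:ℝ) * x - c + (((1 - n : ℤ) : ℝ) * x - c)) / 2 = - (c - x / 2) := by
    push_cast; ring
  have e2 : ((n:ℝ) * x - c - (((1 - n : ℤ) : ℝ) * x - c)) / 2 = (2 * n - 1 : ℕ) * x / 2 := by
    rw [Nat.cast_sub (by omega)]; push_cast; ring
  rw [e1, e2, Real.sin_neg]; ring

theorem EE_node {n : ℕ} (hn : 1 ≤ n) (k : ℕ) (c : ℝ) (i : ℤ) :
    EE n k c (2 * i * π / (2 * n - 1)) = 0 := by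
  obtain ⟨m, h1, t, ht⟩ := exists_alias hn k
  have := LL_alias hn k m h1 ⟨t, ht⟩ c (2 * i * π / (2 * n - 1))
  simp only [Int.cast_natCast] at this
  unfold EE
  rw [this]
  have hn1 : (1:ℝ) ≤ n := by exact_mod_cast hn
  have hN0 : (2 * n - 1 : ℝ) ≠ 0 := by linarith
  have hk : (k:ℝ) = m + (2 * n - 1) * t := by
    have : (k:ℤ) = m + (2 * n - 1) * t := by
      have h3 : ((2 * n - 1 : ℕ) : ℤ) = 2 * n - 1 := by omega
      rw [h3] at ht; linarith
    exact_mod_cast this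
  have : (k:ℝ) * (2 * i * π / (2 * n - 1)) - c =
      (m:ℝ) * (2 * i * π / (2 * n - 1)) - c + ((t * i : ℤ) : ℝ) * (2 * π) := by
    rw [hk]; push_cast; field_simp; ring
  rw [this, Real.cos_add_int_mul_two_pi, sub_self]

theorem LL_hasSum {n : ℕ} {f : ℕ → ℝ → ℝ} {g : ℝ → ℝ} (h : ∀ y, HasSum (fun k => f k y) (g y))
    (x : ℝ) : HasSum (fun k => LL n (f k) x) (LL n g x) := by
  unfold LL
  apply HasSum.mul_left
  apply hasSum_sum
  intro j _
  exact (h _).mul_right _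

/-- The kernel of the interpolation error. -/
noncomputable def KK (ψ βb : ℕ → ℝ) (n : ℕ) (x t : ℝ) : ℝ :=
  ker1 ψ βb (x - t) - LL n (fun y => ker1 ψ βb (y - t)) x

theorem psi_summable {ψ : ℕ → ℝ} (hψ : ∀ k, 0 ≤ ψ k) {n : ℕ} (hn : 1 ≤ n)
    (hdec : ∀ j : ℕ, ψ (n + j) ≤ ψ n * (((n:ℝ)+1)⁻¹) ^ j) : Summable (fun k => ψ (k+1)) := by
  rw [summable_nat_add_iff 1, ← summable_nat_add_iff n]
  refine Summable.of_nonneg_of_le (fun j => hψ _) (fun j => ?_)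
    ((summable_geometric_of_lt_one (r := ((n:ℝ)+1)⁻¹) (by positivity) ?_).mul_left (ψ n))
  · rw [add_comm]; exact hdec j
  · apply inv_lt_one_of_one_lt₀
    have : (1:ℝ) ≤ n := by exact_mod_cast hn
    linarith

theorem ker_term_le {ψ : ℕ → ℝ} (hψ : ∀ k, 0 ≤ ψ k) (k : ℕ) (u : ℝ) :
    ‖ψ k * Real.cos u‖ ≤ ψ k := by
  rw [Real.norm_eq_abs, abs_mul, abs_of_nonneg (hψ k)]
  exact mul_le_of_le_one_right (hψ k) (Real.abs_cos_le_one u)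

theorem ker_hasSum {ψ : ℕ → ℝ} (hψ : ∀ k, 0 ≤ ψ k) (hs : Summable (fun k => ψ (k+1)))
    (βb : ℕ → ℝ) (u : ℝ) :
    HasSum (fun k : ℕ => ψ (k+1) * Real.cos ((k+1 : ℝ) * u - π * βb (k+1) / 2)) (ker1 ψ βb u) :=
  (Summable.of_norm_bounded hs (fun k => ker_term_le hψ (k+1) _)).hasSum

theorem ker_cont {ψ : ℕ → ℝ} (hψ : ∀ k, 0 ≤ ψ k) (hs : Summable (fun k => ψ (k+1)))
    (βb : ℕ → ℝ) : Continuous (ker1 ψ βb) :=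
  continuous_tsum (fun k => by fun_prop) hs (fun k u => ker_term_le hψ (k+1) _)

theorem ker_bound {ψ : ℕ → ℝ} (hψ : ∀ k, 0 ≤ ψ k) (hs : Summable (fun k => ψ (k+1)))
    (βb : ℕ → ℝ) (u : ℝ) : ‖ker1 ψ βb u‖ ≤ ∑' k, ψ (k+1) :=
  tsum_of_norm_bounded hs.hasSum (fun k => ker_term_le hψ (k+1) _)

theorem KK_hasSum {ψ : ℕ → ℝ} (hψ : ∀ k, 0 ≤ ψ k) (hs : Summable (fun k => ψ (k+1)))
    (βb : ℕ → ℝ) (n : ℕ) (x t : ℝ) :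
    HasSum (fun k : ℕ => ψ (k+1) * EE n ((k+1 : ℕ) : ℝ) ((k+1 : ℕ) * t + π * βb (k+1) / 2) x)
      (KK ψ βb n x t) := by
  have h1 := ker_hasSum hψ hs βb (x - t)
  have h2 := LL_hasSum (n := n) (fun y => ker_hasSum hψ hs βb (y - t)) x
  have h3 := h1.sub h2
  unfold KK
  refine Eq.subst (motive := fun F => HasSum F _) (funext fun k => ?_) h3
  symm
  unfold EE
  rw [LL_mul, ← mul_sub]
  have e : ∀ y : ℝ, ((k+1 : ℕ) : ℝ) * y - ((k+1 : ℕ) * t + π * βb (k+1) / 2) =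
    (k+1 : ℝ) * (y - t) - π * βb (k+1) / 2 := by intro y; push_cast; ring
  simp_rw [e]

theorem KK_node {ψ : ℕ → ℝ} (hψ : ∀ k, 0 ≤ ψ k) (hs : Summable (fun k => ψ (k+1)))
    (βb : ℕ → ℝ) {n : ℕ} (hn : 1 ≤ n) (i : ℤ) (t : ℝ) :
    KK ψ βb n (2 * i * π / (2 * n - 1)) t = 0 := by
  have h := KK_hasSum hψ hs βb n (2 * i * π / (2 * n - 1)) t
  simp_rw [EE_node hn, mul_zero] at h
  exact h.unique hasSum_zero

theorem KK_main {ψ : ℕ → ℝ} (hψ : ∀ k, 0 ≤ ψ k) {n : ℕ} (hn : 1 ≤ n)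
    (hdec : ∀ j : ℕ, ψ (n + j) ≤ ψ n * (((n:ℝ)+1)⁻¹) ^ j) (βb : ℕ → ℝ) (x t : ℝ) :
    |KK ψ βb n x t - 2 * ψ n * Real.sin ((2 * n - 1 : ℕ) * x / 2) *
      Real.sin (n * t + π * βb n / 2 - x / 2)| ≤ 2 * ψ n / n := by
  have hs := psi_summable hψ hn hdec
  have h := KK_hasSum hψ hs βb n x t
  obtain ⟨n, rfl⟩ : ∃ n', n = n' + 1 := ⟨n - 1, by omega⟩
  rw [← hasSum_nat_add_iff' (n+1)] at h
  rw [Finset.sum_range_succ, Finset.sum_eq_zero, zero_add, EE_n hn] at h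
  swap
  · intro i hi
    rw [Finset.mem_range] at hi
    rw [EE_low hn (by omega), mul_zero]
  have hn0 : (0:ℝ) < ((n+1 : ℕ) : ℝ) := by positivity
  set q : ℝ := (((n+1 : ℕ) : ℝ) + 1)⁻¹ with hq
  have hq1 : q < 1 := by
    apply inv_lt_one_of_one_lt₀; linarith
  have hg := ((hasSum_geometric_of_lt_one (r := q) (by positivity) hq1).mul_left
    (2 * ψ (n+1) * q))
  have hb := tsum_of_norm_bounded hg (fun j => show
    ‖ψ (j + (n+1) + 1) * EE (n+1) ((j + (n+1) + 1 : ℕ) : ℝ)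
      ((j + (n+1) + 1 : ℕ) * t + π * βb (j + (n+1) + 1) / 2) x‖ ≤ 2 * ψ (n+1) * q * q ^ j by
    rw [Real.norm_eq_abs, abs_mul, abs_of_nonneg (hψ _)]
    have h1 := hdec (j+1)
    rw [show n + 1 + (j + 1) = j + (n+1) + 1 by ring] at h1
    calc _ ≤ (ψ (n+1) * q ^ (j+1)) * 2 := 
          mul_le_mul h1 (EE_le hn _ _ _) (abs_nonneg _) (mul_nonneg (hψ _) (by positivity))
      _ = _ := by ring)
  rw [h.tsum_eq, Real.norm_eq_abs] at hb
  have e : 2 * ψ (n+1) * q * (1 - q)⁻¹ = 2 * ψ (n+1) / (n+1 : ℕ) := by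
    have : 1 - q = ((n+1 : ℕ) : ℝ) * q := by rw [hq]; field_simp; ring
    rw [this]
    have : q ≠ 0 := by rw [hq]; positivity
    field_simp
  rw [e] at hb
  convert hb using 2
  ring

theorem phase {φ : ℝ → ℝ} (hφ : IntervalIntegrable φ volume 0 (2*π))
    (h1 : (∫ t in (0:ℝ)..(2*π), |φ t|) ≤ 1) (n : ℕ) (γ : ℝ) :
    ∃ A δ : ℝ, 0 ≤ A ∧ A ≤ 1 ∧ (∫ t in (0:ℝ)..(2*π), Real.cos (n * t) * φ t) ≤ A ∧
      ∀ s, (∫ t in (0:ℝ)..(2*π), Real.sin (n * t + γ - s) * φ t) = A * Real.sin (δ - s) := by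
  have hint : ∀ g : ℝ → ℝ, Continuous g → IntervalIntegrable (fun t => g t * φ t) volume 0 (2*π) :=
    fun g hg => hφ.continuousOn_mul hg.continuousOn
  set P := ∫ t in (0:ℝ)..(2*π), Real.sin (n * t + γ) * φ t with hP
  set Q := ∫ t in (0:ℝ)..(2*π), Real.cos (n * t + γ) * φ t with hQ
  set z : ℂ := ⟨Q, P⟩
  have hz1 : ‖z‖ * Real.cos z.arg = Q := Complex.norm_mul_cos_arg z
  have hz2 : ‖z‖ * Real.sin z.arg = P := Complex.norm_mul_sin_arg z
  have key : ∀ s, (∫ t in (0:ℝ)..(2*π), Real.sin (n * t + γ - s) * φ t)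
      = ‖z‖ * Real.sin (z.arg - s) := by
    intro s
    have e : ∀ t, Real.sin (n * t + γ - s) * φ t = Real.cos s * (Real.sin (n * t + γ) * φ t) -
        Real.sin s * (Real.cos (n * t + γ) * φ t) := by
      intro t; rw [Real.sin_sub]; ring
    simp_rw [e]
    rw [intervalIntegral.integral_sub ((hint _ (by fun_prop)).const_mul _)
      ((hint _ (by fun_prop)).const_mul _), intervalIntegral.integral_const_mul,
      intervalIntegral.integral_const_mul, ← hP, ← hQ, ← hz1, ← hz2, Real.sin_sub]
    ring
  refine ⟨‖z‖, z.arg, norm_nonneg _, ?_, ?_, key⟩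
  · have h2 := key (z.arg - π/2)
    rw [sub_sub_cancel, Real.sin_pi_div_two, mul_one] at h2
    rw [← h2]
    refine le_trans ?_ h1
    apply intervalIntegral.integral_mono_on Real.two_pi_pos.le (hint _ (by fun_prop)) hφ.abs
    intro t _
    calc _ ≤ |Real.sin (n * t + γ - (z.arg - π/2)) * φ t| := le_abs_self _
      _ ≤ 1 * |φ t| := by
        rw [abs_mul]; gcongr; exact Real.abs_sin_le_one _
      _ = _ := one_mul _
  · have h2 := key (γ - π/2)
    have e : ∀ t, Real.sin (n * t + γ - (γ - π/2)) = Real.cos (n * t) := by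
      intro t
      rw [show (n:ℝ) * t + γ - (γ - π/2) = n * t + π/2 by ring, Real.sin_add_pi_div_two]
    simp_rw [e] at h2
    rw [h2]
    exact mul_le_of_le_one_right (norm_nonneg _) (Real.sin_le_one _)

theorem LL_integral {ψ : ℕ → ℝ} (hψ : ∀ k, 0 ≤ ψ k) (hs : Summable (fun k => ψ (k+1)))
    (βb : ℕ → ℝ) {n : ℕ} (hn : 1 ≤ n) {φ : ℝ → ℝ} (hφ : IntervalIntegrable φ volume 0 (2*π))
    {f : ℝ → ℝ} {a₀ : ℝ} 
    (hf : ∀ x : ℝ, f x = a₀ / 2 + (1/π) * ∫ t in (0:ℝ)..(2*π), ker1 ψ βb (x - t) * φ t) (x : ℝ) :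
    f x - LL n f x = (1/π) * ∫ t in (0:ℝ)..(2*π), KK ψ βb n x t * φ t := by
  have hint : ∀ y : ℝ, IntervalIntegrable (fun t => ker1 ψ βb (y - t) * φ t) volume 0 (2*π) :=
    fun y => hφ.continuousOn_mul
      ((ker_cont hψ hs βb).comp (continuous_const.sub continuous_id)).continuousOn
  have hfe : f = fun y => a₀ / 2 * Real.cos ((0:ℕ) * y - 0) +
      (1/π) * ∫ t in (0:ℝ)..(2*π), ker1 ψ βb (y - t) * φ t := by
    ext y; rw [hf]; simp
  have hL : LL n f x = a₀ / 2 + (1/π) * LL n (fun y => ∫ t in (0:ℝ)..(2*π),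
      ker1 ψ βb (y - t) * φ t) x := by
    rw [hfe, LL_add, LL_mul, LL_mul, LL_cos_nat hn (by omega)]; simp
  have hL2 : LL n (fun y => ∫ t in (0:ℝ)..(2*π), ker1 ψ βb (y - t) * φ t) x =
      ∫ t in (0:ℝ)..(2*π), LL n (fun y => ker1 ψ βb (y - t)) x * φ t := by
    unfold LL
    simp_rw [← intervalIntegral.integral_mul_const]
    rw [← intervalIntegral.integral_finsetSum, ← intervalIntegral.integral_const_mul]
    · congr 1; ext t
      rw [mul_assoc, Finset.sum_mul]
      congr 1
      apply Finset.sum_congr rfl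
      intro j _; ring
    · intro j _
      exact (hint _).mul_const _
  have hint2 : IntervalIntegrable (fun t => LL n (fun y => ker1 ψ βb (y - t)) x * φ t)
      volume 0 (2*π) := by
    apply hφ.continuousOn_mul
    apply Continuous.continuousOn
    unfold LL
    have hk := ker_cont hψ hs βb
    fun_prop
  rw [hL, hL2, hf]
  unfold KK
  simp_rw [sub_mul]
  rw [intervalIntegral.integral_sub (hint x) hint2]
  ring

theorem f_cont {ψ : ℕ → ℝ} (hψ : ∀ k, 0 ≤ ψ k) (hs : Summable (fun k => ψ (k+1)))
    (βb : ℕ → ℝ) {φ : ℝ → ℝ} (hφ : IntervalIntegrable φ volume 0 (2*π))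
    {f : ℝ → ℝ} {a₀ : ℝ} 
    (hf : ∀ x : ℝ, f x = a₀ / 2 + (1/π) * ∫ t in (0:ℝ)..(2*π), ker1 ψ βb (x - t) * φ t) :
    Continuous f := by
  have hk := ker_cont hψ hs βb
  rw [show f = _ from funext hf]
  refine continuous_const.add (continuous_const.mul ?_)
  apply intervalIntegral.continuous_of_dominated_interval
    (bound := fun t => (∑' k, ψ (k+1)) * ‖φ t‖)
  · intro x
    have := (hφ.continuousOn_mul
      (hk.comp (continuous_const.sub continuous_id : Continuous fun t => x - t)).continuousOn)
    exact (intervalIntegrable_iff.1 this).aestronglyMeasurable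
  · intro x
    refine Filter.Eventually.of_forall fun t _ => ?_
    rw [norm_mul]
    gcongr
    exact ker_bound hψ hs βb _
  · exact hφ.norm.const_mul _
  · refine Filter.Eventually.of_forall fun t _ => ?_
    fun_prop

theorem err_struct {ψ : ℕ → ℝ} (hψ : ∀ k, 0 ≤ ψ k) {n : ℕ} (hn : 1 ≤ n)
    (hdec : ∀ j : ℕ, ψ (n + j) ≤ ψ n * (((n:ℝ)+1)⁻¹) ^ j) (βb : ℕ → ℝ)
    {φ : ℝ → ℝ} (hφ : AdmPhi φ) {f : ℝ → ℝ} {a₀ : ℝ} 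
    (hf : ∀ x : ℝ, f x = a₀ / 2 + (1/π) * ∫ t in (0:ℝ)..(2*π), ker1 ψ βb (x - t) * φ t)
    {p : ℝ≥0∞} (hp : 1 ≤ p) :
    ∃ A δ : ℝ, 0 ≤ A ∧ A ≤ 1 ∧ (∫ t in (0:ℝ)..(2*π), Real.cos (n * t) * φ t) ≤ A ∧
      |LpNormPer p (fun x => f x - LL n f x) - 2 * ψ n / π * (A * FF p (2 * n - 1) δ)|
        ≤ 4 * ψ n / n := by
  have hs := psi_summable hψ hn hdec
  obtain ⟨-, hφi, -, hφ1⟩ := hφ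
  have hφI : IntervalIntegrable φ volume 0 (2*π) :=
    (intervalIntegrable_iff_integrableOn_Ioc_of_le Real.two_pi_pos.le).2 hφi
  have hn0 : (0:ℝ) < n := by exact_mod_cast hn
  obtain ⟨A, δ, hA0, hA1, hAc, hA⟩ := phase hφI hφ1 n (π * βb n / 2)
  refine ⟨A, δ, hA0, hA1, hAc, ?_⟩
  set M : ℝ → ℝ := fun x => (2 * ψ n / π * A) *
    (Real.sin ((2 * n - 1 : ℕ) * x / 2) * Real.sin (δ - x / 2)) with hM
  set g : ℝ → ℝ := fun x => f x - LL n f x with hg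
  have hMc : Continuous M := by rw [hM]; fun_prop
  have hgc : Continuous g := (f_cont hψ hs βb hφI hf).sub (LL_cont n f)
  have hKc : ∀ x, IntervalIntegrable (fun t => KK ψ βb n x t * φ t) volume 0 (2*π) := by
    intro x
    apply hφI.continuousOn_mul
    apply Continuous.continuousOn
    unfold KK LL
    have hk := ker_cont hψ hs βb
    fun_prop
  have hrem : ∀ x, |g x - M x| ≤ 2 * ψ n / n * (1/π) := by
    intro x
    have e1 : g x = (1/π) * ∫ t in (0:ℝ)..(2*π), KK ψ βb n x t * φ t :=
      LL_integral hψ hs βb hn hφI hf x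
    have e2 : M x = (1/π) * ∫ t in (0:ℝ)..(2*π), (2 * ψ n *
        Real.sin ((2 * n - 1 : ℕ) * x / 2) * Real.sin (n * t + π * βb n / 2 - x / 2)) * φ t := by
      simp_rw [mul_assoc (2 * ψ n * Real.sin ((2 * n - 1 : ℕ) * x / 2))]
      rw [intervalIntegral.integral_const_mul, hA]
      simp only [hM]; ring
    rw [e1, e2, ← mul_sub, ← intervalIntegral.integral_sub (hKc x)
      (hφI.continuousOn_mul (Continuous.continuousOn (by fun_prop))), abs_mul]
    have hb : ‖∫ t in (0:ℝ)..(2*π), (KK ψ βb n x t * φ t - (2 * ψ n *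
        Real.sin ((2 * n - 1 : ℕ) * x / 2) * Real.sin (n * t + π * βb n / 2 - x / 2)) * φ t)‖ ≤
        ∫ t in (0:ℝ)..(2*π), 2 * ψ n / n * |φ t| := by
      apply intervalIntegral.norm_integral_le_of_norm_le Real.two_pi_pos.le _
        (hφI.abs.const_mul _)
      refine Filter.Eventually.of_forall fun t _ => ?_
      rw [← sub_mul, norm_mul, Real.norm_eq_abs, Real.norm_eq_abs]
      gcongr
      exact KK_main hψ hn hdec βb x t
    rw [intervalIntegral.integral_const_mul, Real.norm_eq_abs] at hb
    have h0 : 0 ≤ 2 * ψ n / n := div_nonneg (by linarith [hψ n]) hn0.le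
    have hb2 := hb.trans (mul_le_of_le_one_right h0 hφ1)
    rw [abs_of_pos (by positivity : 0 < 1/π), mul_comm]
    gcongr
  have hrem0 : 0 ≤ 2 * ψ n / n * (1/π) :=
    mul_nonneg (div_nonneg (by linarith [hψ n]) hn0.le) (by positivity)
  have hc : 2 * ψ n / n * (1/π) * (2 * π) = 4 * ψ n / n := by
    field_simp; ring
  have hMn : LpNormPer p M = 2 * ψ n / π * (A * FF p (2 * n - 1) δ) := by
    rw [hM, lp_const_mul, abs_of_nonneg]
    · unfold FF; ring
    · exact mul_nonneg (div_nonneg (by linarith [hψ n]) Real.pi_pos.le) hA0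
  rw [← hMn, abs_le]
  have u1 := lp_add_le (f := M) (g := fun x => g x - M x) hMc (hgc.sub hMc) hp
  have u2 := lp_add_le (f := g) (g := fun x => M x - g x) hgc (hMc.sub hgc) hp
  have v1 := lp_bound (f := fun x => g x - M x) hrem0 hrem hp
  have v2 := lp_bound (f := fun x => M x - g x) hrem0
    (fun x => by rw [abs_sub_comm]; exact hrem x) hp
  simp only [add_sub_cancel] at u1 u2
  rw [hc] at v1 v2
  have w1 : LpNormPer p (fun x => g x) = LpNormPer p g := rfl
  have w2 : LpNormPer p (fun x => M x) = LpNormPer p M := rfl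
  rw [w1] at u1
  rw [w2] at u2
  constructor <;> linarith

theorem exists_phi {n : ℕ} (hn : 1 ≤ n) :
    ∃ φ : ℝ → ℝ, AdmPhi φ ∧ 1 - 1 / (n:ℝ) ≤ ∫ t in (0:ℝ)..(2*π), Real.cos (n * t) * φ t := by
  have hn0 : (0:ℝ) < n := by exact_mod_cast hn
  set W := ∫ x in (0:ℝ)..(2*π), |Real.cos x| ^ (2*n+1) with hW
  have hWpos : 0 < W := by
    apply intervalIntegral.integral_pos Real.two_pi_pos (Continuous.continuousOn (by fun_prop))
    · intro x _; positivity
    · exact ⟨0, ⟨le_rfl, Real.two_pi_pos.le⟩, by simp⟩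
  have hcosn : Continuous fun t : ℝ => Real.cos (n * t) := by fun_prop
  have hodd : ∫ x in (0:ℝ)..(2*π), Real.cos x ^ (2*n+1) = 0 := by
    have hper : Function.Periodic (fun x => Real.cos x ^ (2*n+1)) (2*π) := fun x => by simp
    have := integral_shift hper π
    have e : ∀ x, Real.cos (x + π) ^ (2*n+1) = - Real.cos x ^ (2*n+1) := fun x => by
      rw [Real.cos_add_pi, Odd.neg_pow ⟨n, rfl⟩]
    simp_rw [e] at this
    rw [intervalIntegral.integral_neg] at this
    linarith
  have hc : Continuous fun t : ℝ => W⁻¹ * Real.cos (n * t) ^ (2*n+1) := by fun_prop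
  refine ⟨fun t => W⁻¹ * Real.cos (n * t) ^ (2*n+1), ⟨?_, ?_, ?_, ?_⟩, ?_⟩
  · intro t
    have : (n:ℝ) * (t + 2*π) = n * t + n * (2*π) := by ring
    simp only [this, Real.cos_add_nat_mul_two_pi]
  · exact (hc.intervalIntegrable 0 (2*π)).1
  · rw [intervalIntegral.integral_const_mul,
      integral_scale (g := fun x => Real.cos x ^ (2*n+1)) (by fun_prop) (fun x => by simp) hn,
      hodd, mul_zero]
  · simp_rw [abs_mul, abs_pow]
    rw [intervalIntegral.integral_const_mul,
      integral_scale (g := fun x => |Real.cos x| ^ (2*n+1)) (by fun_prop) (fun x => by simp) hn,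
      abs_of_pos (by positivity), ← hW, inv_mul_cancel₀ hWpos.ne']
  · have e : ∀ t, Real.cos (n * t) * (W⁻¹ * Real.cos (n * t) ^ (2*n+1)) =
        W⁻¹ * Real.cos (n * t) ^ (2*n+2) := fun t => by ring
    simp_rw [e]
    rw [intervalIntegral.integral_const_mul,
      integral_scale (g := fun x => Real.cos x ^ (2*n+2)) (by fun_prop) (fun x => by simp) hn,
      integral_cos_pow]
    have hle : W ≤ ∫ x in (0:ℝ)..(2*π), Real.cos x ^ (2*n) := by
      apply intervalIntegral.integral_mono_on Real.two_pi_pos.le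
        (Continuous.intervalIntegrable (by fun_prop) _ _)
        (Continuous.intervalIntegrable (by fun_prop) _ _)
      intro x _
      have : Real.cos x ^ (2*n) = |Real.cos x| ^ (2*n) := by
        rw [pow_mul, pow_mul, sq_abs]
      rw [this]
      exact pow_le_pow_of_le_one (abs_nonneg _) (Real.abs_cos_le_one x) (by omega)
    simp only [Real.sin_two_pi, Real.sin_zero, mul_zero, sub_zero, zero_div, zero_add]
    rw [le_inv_mul_iff₀ hWpos]
    have h1 : 1 - 1 / (n:ℝ) ≤ (((2 * n : ℕ) : ℝ) + 1) / (((2 * n : ℕ) : ℝ) + 2) := by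
      push_cast
      rw [le_div_iff₀ (by positivity)]
      have : (1 - 1/(n:ℝ)) * (2 * n + 2) = 2 * n - 2/n := by field_simp; ring
      rw [this]
      have : 0 < 2/(n:ℝ) := by positivity
      linarith
    calc W * (1 - 1/(n:ℝ)) ≤ W * ((((2 * n : ℕ) : ℝ) + 1) / (((2 * n : ℕ) : ℝ) + 2)) := by gcongr
      _ = (((2 * n : ℕ) : ℝ) + 1) / (((2 * n : ℕ) : ℝ) + 2) * W := mul_comm _ _
      _ ≤ _ := by gcongr

theorem interp_unique {n : ℕ} (hn : 1 ≤ n) {T f : ℝ → ℝ} (h : InterpolatesAt n T f) (x : ℝ) :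
    T x = LL n f x := by
  rw [← LL_trig hn h.1 x]
  apply LL_congr
  intro j
  have := h.2 j
  have e : ((2 * n - 1 : ℕ) : ℝ) = 2 * (n:ℝ) - 1 := by
    rw [Nat.cast_sub (by omega)]; push_cast; ring
  rw [e]
  simpa using this

theorem psi_dec {r α : ℝ} (hr : 1 < r) (hα : 0 < α) {n : ℕ} (hn : 1 ≤ n)
    (h : (n:ℝ) ^ ((1:ℝ) - r) * Real.log ((n:ℝ)+1) ≤ α * r) (j : ℕ) :
    Real.exp (-α * ((n + j : ℕ) : ℝ) ^ r) ≤
      Real.exp (-α * (n : ℝ) ^ r) * (((n:ℝ)+1)⁻¹) ^ j := by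
  have hn0 : (0:ℝ) < n := by exact_mod_cast hn
  have hb : (n:ℝ) ^ r + r * (n:ℝ) ^ (r - 1) * j ≤ ((n + j : ℕ) : ℝ) ^ r := by
    have hj : (0:ℝ) ≤ j / n := by positivity
    have h1 := one_add_mul_self_le_rpow_one_add (s := j / n) (by linarith) hr.le
    have e : ((n + j : ℕ) : ℝ) = n * (1 + j / n) := by push_cast; field_simp
    rw [e, Real.mul_rpow hn0.le (by linarith)]
    calc (n:ℝ) ^ r + r * (n:ℝ) ^ (r - 1) * j = (n:ℝ) ^ r * (1 + r * (j / n)) := by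
          rw [Real.rpow_sub_one hn0.ne']; field_simp
      _ ≤ _ := by gcongr
  have hl : Real.log ((n:ℝ)+1) ≤ α * r * (n:ℝ) ^ (r - 1) := by
    have hpos : 0 < (n:ℝ) ^ (r - 1) := by positivity
    have := mul_le_mul_of_nonneg_right h hpos.le
    have e : (n:ℝ) ^ ((1:ℝ) - r) * (n:ℝ) ^ (r - 1) = 1 := by
      rw [← Real.rpow_add hn0]; simp
    calc Real.log ((n:ℝ)+1) = (n:ℝ) ^ ((1:ℝ) - r) * (n:ℝ) ^ (r - 1) * Real.log ((n:ℝ)+1) := by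
          rw [e, one_mul]
      _ = (n:ℝ) ^ ((1:ℝ) - r) * Real.log ((n:ℝ)+1) * (n:ℝ) ^ (r - 1) := by ring
      _ ≤ _ := this
  have e : (((n:ℝ)+1)⁻¹) ^ j = Real.exp (-(Real.log ((n:ℝ)+1)) * j) := by
    rw [mul_comm, Real.exp_nat_mul, Real.exp_neg, Real.exp_log (by positivity)]
  rw [e, ← Real.exp_add, Real.exp_le_exp]
  have h2 := mul_le_mul_of_nonneg_left hb hα.le
  have h3 := mul_le_mul_of_nonneg_right hl (Nat.cast_nonneg (α := ℝ) j)
  nlinarith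

theorem main_const {q : ℝ} (c : ℝ) :
    (2:ℝ) ^ ((1:ℝ) - 1/q) / π ^ ((1:ℝ) + 1/q) * c = 2 / π * ((2*π) ^ (-(1/q)) * c) := by
  rw [Real.mul_rpow two_pos.le Real.pi_pos.le, sub_eq_add_neg, Real.rpow_add two_pos,
    Real.rpow_add Real.pi_pos, Real.rpow_neg Real.pi_pos.le, Real.rpow_one, Real.rpow_one]
  have : 0 < π ^ (1/q) := by positivity
  field_simp

theorem interp_est {ψ : ℕ → ℝ} (hψ : ∀ k, 0 ≤ ψ k) {n : ℕ} (hn : 1 ≤ n)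
    (hdec : ∀ j : ℕ, ψ (n + j) ≤ ψ n * (((n:ℝ)+1)⁻¹) ^ j) (βb : ℕ → ℝ)
    {p : ℝ≥0∞} (hp : 1 ≤ p) :
    |interpErr p n (ClassC ψ βb) - 2 * ψ n / π * ((2*π) ^ (-(1/p.toReal)) * cosLp p ^ 2)| ≤
      (4 * π + 8) * ψ n / n := by
  have hn0 : (0:ℝ) < n := by exact_mod_cast hn
  have hs := psi_summable hψ hn hdec
  have hψn := hψ n
  set M := (2*π) ^ (-(1/p.toReal)) * cosLp p ^ 2 with hM
  have hFM : ∀ δ, |FF p (2*n-1) δ - M| ≤ 2 * π ^ 2 / n := by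
    intro δ
    refine (FF_main hp (by omega) δ).trans ?_
    have hN : (n:ℝ) ≤ (2*n-1 : ℕ) := by exact_mod_cast (by omega : n ≤ 2*n-1)
    calc π / (2*n-1 : ℕ) * (2*π) ≤ π / n * (2*π) := by gcongr
      _ = _ := by ring
  have hF2 : ∀ δ, FF p (2*n-1) δ ≤ 2 * π := by
    intro δ
    have := lp_bound (p := p) (c := 1)
      (f := fun x => Real.sin ((2*n-1 : ℕ) * x / 2) * Real.sin (δ - x / 2)) zero_le_one
      (fun x => by
        rw [abs_mul]
        exact mul_le_one₀ (Real.abs_sin_le_one _) (abs_nonneg _) (Real.abs_sin_le_one _)) hp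
    rw [one_mul] at this
    exact this
  have hF0 : ∀ δ, 0 ≤ FF p (2*n-1) δ := fun δ => lp_nonneg _ _
  have hk0 : 0 ≤ 2 * ψ n / π := by positivity
  have hup : ∀ e ∈ { e : ℝ | ∃ f ∈ ClassC ψ βb, ∃ T : ℝ → ℝ, InterpolatesAt n T f ∧
      e = LpNormPer p (fun x => f x - T x) }, e ≤ 2 * ψ n / π * M + (4 * π + 8) * ψ n / n := by
    rintro e ⟨f, ⟨a₀, φ, hφ, hf⟩, T, hT, rfl⟩
    have hTe : T = LL n f := funext (interp_unique hn hT)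
    rw [hTe]
    obtain ⟨A, δ, hA0, hA1, -, hb⟩ := err_struct hψ hn hdec βb hφ hf hp
    have h1 : A * FF p (2*n-1) δ ≤ M + 2 * π ^ 2 / n := by
      have := (abs_le.1 (hFM δ)).2
      have := mul_le_of_le_one_left (hF0 δ) hA1
      linarith
    have h2 := mul_le_mul_of_nonneg_left h1 hk0
    have e1 : 2 * ψ n / π * (M + 2 * π ^ 2 / n) = 2 * ψ n / π * M + 4 * π * ψ n / n := by
      field_simp; ring
    have e2 : (4 * π + 8) * ψ n / n = 4 * π * ψ n / n + 4 * ψ n / n + 4 * ψ n / n := by ring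
    have h3 : 0 ≤ 4 * ψ n / n := by positivity
    have := (abs_le.1 hb).2
    linarith
  obtain ⟨φ, hφ, hφc⟩ := exists_phi hn
  set f : ℝ → ℝ := fun x => (0:ℝ) / 2 + (1/π) * ∫ t in (0:ℝ)..(2*π), ker1 ψ βb (x - t) * φ t
    with hf
  have hf' : ∀ x, f x = (0:ℝ) / 2 + (1/π) * ∫ t in (0:ℝ)..(2*π), ker1 ψ βb (x - t) * φ t :=
    fun x => rfl
  have hφI : IntervalIntegrable φ volume 0 (2*π) :=
    (intervalIntegrable_iff_integrableOn_Ioc_of_le Real.two_pi_pos.le).2 hφ.2.1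
  have hmem : LpNormPer p (fun x => f x - LL n f x) ∈ { e : ℝ | ∃ f ∈ ClassC ψ βb, ∃ T : ℝ → ℝ,
      InterpolatesAt n T f ∧ e = LpNormPer p (fun x => f x - T x) } := by
    refine ⟨f, ⟨0, φ, hφ, hf'⟩, LL n f, ⟨LL_isTrig n f, fun k => ?_⟩, rfl⟩
    have := LL_integral hψ hs βb hn hφI hf' (2 * (k:ℝ) * π / (2 * (n:ℝ) - 1))
    simp_rw [KK_node hψ hs βb hn] at this
    simp only [zero_mul, intervalIntegral.integral_zero, mul_zero] at this
    linarith
  have hlow : 2 * ψ n / π * M - (4 * π + 8) * ψ n / n ≤ LpNormPer p (fun x => f x - LL n f x) := by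
    obtain ⟨A, δ, hA0, hA1, hAc, hb⟩ := err_struct hψ hn hdec βb hφ hf' hp
    have h1 : M - 2 * π ^ 2 / n - 2 * π / n ≤ A * FF p (2*n-1) δ := by
      have h2 := (abs_le.1 (hFM δ)).1
      have h3 : (1 - 1/(n:ℝ)) * FF p (2*n-1) δ ≤ A * FF p (2*n-1) δ :=
        mul_le_mul_of_nonneg_right (hφc.trans hAc) (hF0 δ)
      have h4 : 1/(n:ℝ) * FF p (2*n-1) δ ≤ 1/(n:ℝ) * (2*π) :=
        mul_le_mul_of_nonneg_left (hF2 δ) (by positivity)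
      have h5 : 1/(n:ℝ) * (2*π) = 2 * π / n := by ring
      linarith
    have h2 := mul_le_mul_of_nonneg_left h1 hk0
    have e1 : 2 * ψ n / π * (M - 2 * π ^ 2 / n - 2 * π / n) =
        2 * ψ n / π * M - 4 * π * ψ n / n - 4 * ψ n / n := by
      field_simp; ring
    have e2 : (4 * π + 8) * ψ n / n = 4 * π * ψ n / n + 4 * ψ n / n + 4 * ψ n / n := by ring
    have := (abs_le.1 hb).1
    linarith
  have s1 : interpErr p n (ClassC ψ βb) ≤ 2 * ψ n / π * M + (4 * π + 8) * ψ n / n :=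
    csSup_le ⟨_, hmem⟩ hup
  have s2 : LpNormPer p (fun x => f x - LL n f x) ≤ interpErr p n (ClassC ψ βb) :=
    le_csSup ⟨_, hup⟩ hmem
  rw [abs_le]; constructor <;> linarith


/-- **Theorem 2.** For `ψ(k) = e^{−αk^r}` (classes `C^{α,r}_{β̄,1}`), for all `n` with
`n^{1−r} ln(n+1) ≤ αr`:
`|Ẽ_n(C^{α,r}_{β̄,1})_{L_p} − e^{−αn^r}(2^{1−1/p}/π^{1+1/p})‖cos‖_p²| ≤ C e^{−αn^r}/n`. -/
theorem statement2 :
    ∃ C : ℝ, 0 < C ∧ ∀ (r α : ℝ), 1 < r → 0 < α → ∀ (p : ℝ≥0∞), 1 ≤ p →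
      ∀ (βb : ℕ → ℝ), ∀ n : ℕ, 1 ≤ n →
        (n:ℝ) ^ ((1:ℝ) - r) * Real.log ((n:ℝ)+1) ≤ α * r →
        |interpErr p n (ClassC (fun k : ℕ => Real.exp (-α * (k:ℝ) ^ r)) βb) -
            Real.exp (-α * (n:ℝ) ^ r) *
              (2 ^ ((1:ℝ) - 1/p.toReal) / π ^ ((1:ℝ) + 1/p.toReal) * (cosLp p) ^ 2)| ≤
          C * Real.exp (-α * (n:ℝ) ^ r) / n := by
  refine ⟨4 * π + 8, by positivity, ?_⟩
  intro r α hr hα p hp βb n hn h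
  have := interp_est (ψ := fun k : ℕ => Real.exp (-α * (k:ℝ) ^ r)) (fun k => (Real.exp_pos _).le)
    hn (psi_dec hr hα hn h) βb hp
  rw [main_const]
  convert this using 3
  ring
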